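/- Fix ε > 0 and suppose the revealing probabilities are p_t = min((1+ε)·((a+b)/b)·κ*(a,b)/t, 1). Then there exists a constant C_1 < ∞ (depending on a, b, ε) such that for all sufficiently large t, P_1(R_t^{(1)} ≤ t^{−C_1}) ≤ t^{−2}, where R_t^{(1)} := ∏_{i ∈ A_t} R_i/R_{i-1} and A_t := {i ∈ {1,...,t} : R_{i-1} > a/b}. -/

import Mathlib

open MeasureTheory ProbabilityTheory Filter Asymptotics
open scoped ENNReal NNReal

noncomputable section

/-- The constant `κ*(a,b)` from the paper. -/
def kappaStar (a b : ℝ) : ℝ :=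
  1 / (1 + (a / b - 1) / Real.log (a / b) *
      (Real.log ((a / b - 1) / Real.log (a / b)) - 1))

/-- The signal distribution: `signalProb a b i x = P(X_t = x | θ = i)`,
equal to `a/(a+b)` if `x = i` and `b/(a+b)` otherwise. -/
def signalProb (a b : ℝ) (i x : ℕ) : ℝ :=
  if x = i then a / (a + b) else b / (a + b)

/-- The D-likelihood `D_i^t = Q_i^t(Z_1,…,Z_{t-1},X_t)`: the conditional probability, given
`θ = i`, of observing the actions `Z_1,…,Z_{t-1}` and private signal `X_t` that actually
occurred at the sample point `ω`. -/
def Dlike {Ω : Type*} [MeasurableSpace Ω] (μ : Measure Ω) (θ : Ω → ℕ)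
    (X Z : ℕ → Ω → ℕ) (t : ℕ) (i : ℕ) (ω : Ω) : ℝ :=
  (μ {ω' | θ ω' = i ∧ (∀ s ∈ Finset.Icc 1 (t - 1), Z s ω' = Z s ω) ∧ X t ω' = X t ω}).toReal
    / (μ {ω' | θ ω' = i}).toReal

/-- The maximum a posteriori estimate of `θ` given `(Z_1,…,Z_{t-1},X_t)`, with ties broken
by following the private signal `X_t`.  (The prior on `θ` is uniform, so comparing the
posteriors amounts to comparing `D_1^t` and `D_2^t`.) -/
def mapEst {Ω : Type*} [MeasurableSpace Ω] (μ : Measure Ω) (θ : Ω → ℕ)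
    (X Z : ℕ → Ω → ℕ) (t : ℕ) (ω : Ω) : ℕ :=
  if Dlike μ θ X Z t 2 ω < Dlike μ θ X Z t 1 ω then 1
  else if Dlike μ θ X Z t 1 ω < Dlike μ θ X Z t 2 ω then 2
  else X t ω

/-- The L-likelihood `L_i^t = P_i(Z_1 = z_1, …, Z_t = z_t)` evaluated at the observed
actions. -/
def Llike {Ω : Type*} [MeasurableSpace Ω] (μ : Measure Ω) (θ : Ω → ℕ)
    (Z : ℕ → Ω → ℕ) (t : ℕ) (i : ℕ) (ω : Ω) : ℝ :=
  (μ {ω' | θ ω' = i ∧ ∀ s ∈ Finset.Icc 1 t, Z s ω' = Z s ω}).toReal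
    / (μ {ω' | θ ω' = i}).toReal

/-- The likelihood ratio `R_t = L_1^t / L_2^t` (with `R_0 = 1`). -/
def LR {Ω : Type*} [MeasurableSpace Ω] (μ : Measure Ω) (θ : Ω → ℕ)
    (Z : ℕ → Ω → ℕ) (t : ℕ) (ω : Ω) : ℝ :=
  Llike μ θ Z t 1 ω / Llike μ θ Z t 2 ω

/-- The sequential decision making model with Bayesians and revealers.
`θ` is the state of the world, uniform on `{1,2}`; given `θ`, the signals `X_t` are i.i.d.
with `P(X_t = θ | θ) = a/(a+b)`, the revealing indicators `I_t` are independent Bernoulli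
with `E[I_t] = p_t`, independent of everything else (this is the content of `joint`), and
the actions are `Z_t = X_t` if `I_t = 1` and `Z_t = MAP(Z_1,…,Z_{t-1},X_t)` if `I_t = 0`
(field `dynamics`).  Players are indexed by `t ≥ 1`; `Z 0` is set to the constant `1` for
definiteness. -/
structure IsCascade (a b : ℝ) (p : ℕ → ℝ) {Ω : Type*} [MeasurableSpace Ω]
    (μ : Measure Ω) (θ : Ω → ℕ) (X I Z : ℕ → Ω → ℕ) : Prop where
  prob : IsProbabilityMeasure μ
  theta_meas : Measurable θ
  X_meas : ∀ t, Measurable (X t)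
  I_meas : ∀ t, Measurable (I t)
  Z_meas : ∀ t, Measurable (Z t)
  p_mem : ∀ t : ℕ, 1 ≤ t → p t ∈ Set.Icc (0 : ℝ) 1
  theta_range : ∀ ω, θ ω = 1 ∨ θ ω = 2
  X_range : ∀ t ω, X t ω = 1 ∨ X t ω = 2
  I_range : ∀ t ω, I t ω = 0 ∨ I t ω = 1
  Z_zero : ∀ ω, Z 0 ω = 1
  joint : ∀ i : ℕ, i = 1 ∨ i = 2 → ∀ s : Finset ℕ, (∀ t ∈ s, 1 ≤ t) →
    ∀ x c : ℕ → ℕ, (∀ t, x t = 1 ∨ x t = 2) → (∀ t, c t = 0 ∨ c t = 1) →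
    (μ {ω | θ ω = i ∧ ∀ t ∈ s, X t ω = x t ∧ I t ω = c t}).toReal
      = 1 / 2 * ∏ t ∈ s, signalProb a b i (x t) * (if c t = 1 then p t else 1 - p t)
  dynamics : ∀ t : ℕ, 1 ≤ t → ∀ ω,
    Z t ω = if I t ω = 1 then X t ω else mapEst μ θ X Z t ω

/-- The error probability `E_t = P(Z_t ≠ θ)`. -/
def errProb {Ω : Type*} [MeasurableSpace Ω] (μ : Measure Ω) (θ : Ω → ℕ)
    (Z : ℕ → Ω → ℕ) (t : ℕ) : ℝ :=
  (μ {ω | Z t ω ≠ θ ω}).toReal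

/-- The probability that the MAP estimator is wrong at time `t`:
`P(MAP(Z_1,…,Z_{t-1},X_t) ≠ θ)`. -/
def mapErr {Ω : Type*} [MeasurableSpace Ω] (μ : Measure Ω) (θ : Ω → ℕ)
    (X Z : ℕ → Ω → ℕ) (t : ℕ) : ℝ :=
  (μ {ω | mapEst μ θ X Z t ω ≠ θ ω}).toReal

/-- `R_t^{(1)} = ∏_{i ∈ A_t} R_i/R_{i-1}` where `A_t = {i ∈ {1,…,t} : R_{i-1} > a/b}`. -/
def Rone {Ω : Type*} [MeasurableSpace Ω] (a b : ℝ) (μ : Measure Ω) (θ : Ω → ℕ)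
    (Z : ℕ → Ω → ℕ) (t : ℕ) (ω : Ω) : ℝ :=
  ∏ i ∈ (Finset.Icc 1 t).filter (fun i => a / b < LR μ θ Z (i - 1) ω),
    LR μ θ Z i ω / LR μ θ Z (i - 1) ω

section helpers

variable {Ω : Type*} [MeasurableSpace Ω] {μ : Measure Ω} {θ : Ω → ℕ}
  {X I Z : ℕ → Ω → ℕ} {a b : ℝ} {p : ℕ → ℝ}

lemma indep_aux (hC : IsCascade a b p μ θ X I Z) (j : ℕ) (hj : j = 1 ∨ j = 2) (n : ℕ)
    (S : Set Ω)
    (hS : ∀ ω ω', (∀ r ∈ Finset.Icc 1 n, X r ω = X r ω' ∧ I r ω = I r ω') → ω ∈ S → ω' ∈ S)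
    (x c : ℕ) (hx : x = 1 ∨ x = 2) (hc : c = 0 ∨ c = 1) :
    μ.real {ω | θ ω = j ∧ ω ∈ S ∧ X (n+1) ω = x ∧ I (n+1) ω = c}
      = μ.real {ω | θ ω = j ∧ ω ∈ S} *
        (signalProb a b j x * (if c = 1 then p (n+1) else 1 - p (n+1))) := by
  classical
  have := hC.prob
  let f : Ω → (Finset.Icc 1 n → Bool × Bool) :=
    fun ω r => (decide (X r ω = 1), decide (I r ω = 1))
  have hf : Measurable f := by
    refine measurable_pi_lambda _ fun r => Measurable.prodMk ?_ ?_
    · exact (measurable_of_countable (fun k : ℕ => decide (k = 1))).comp (hC.X_meas r)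
    · exact (measurable_of_countable (fun k : ℕ => decide (k = 1))).comp (hC.I_meas r)
  have hsum : ∀ A : Set Ω, μ.real A = ∑ v, μ.real (f ⁻¹' {v} ∩ A) := by
    intro A
    have h := sum_measureReal_preimage_singleton (μ := μ.restrict A) (f := f) Finset.univ
      (fun y _ => hf (measurableSet_singleton y))
    simp only [Finset.coe_univ, Set.preimage_univ] at h
    rw [measureReal_restrict_apply MeasurableSet.univ, Set.univ_inter] at h
    rw [← h]
    refine Finset.sum_congr rfl fun v _ => ?_
    rw [measureReal_restrict_apply (hf (measurableSet_singleton v))]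
  rw [hsum {ω | θ ω = j ∧ ω ∈ S ∧ X (n+1) ω = x ∧ I (n+1) ω = c},
    hsum {ω | θ ω = j ∧ ω ∈ S}, Finset.sum_mul]
  refine Finset.sum_congr rfl fun v _ => ?_
  have hfeq : ∀ ω ω', f ω = f ω' → ∀ r ∈ Finset.Icc 1 n, X r ω = X r ω' ∧ I r ω = I r ω' := by
    intro ω ω' h r hr
    have h1 := congrFun h ⟨r, hr⟩
    simp only [f, Prod.mk.injEq, decide_eq_decide] at h1
    have := hC.X_range r ω
    have := hC.X_range r ω'
    have := hC.I_range r ω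
    have := hC.I_range r ω'
    omega
  by_cases hv : ∃ ω₀ ∈ S, f ω₀ = v
  · obtain ⟨ω₀, hω₀, rfl⟩ := hv
    have e1 : f ⁻¹' {f ω₀} ∩ {ω | θ ω = j ∧ ω ∈ S} =
        {ω | θ ω = j ∧ ∀ t ∈ Finset.Icc 1 n, X t ω = X t ω₀ ∧ I t ω = I t ω₀} := by
      ext ω
      simp only [Set.mem_inter_iff, Set.mem_preimage, Set.mem_singleton_iff, Set.mem_setOf_eq]
      constructor
      · rintro ⟨h1, h2, h3⟩
        exact ⟨h2, hfeq _ _ h1⟩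
      · rintro ⟨h1, h2⟩
        refine ⟨?_, h1, hS ω₀ ω (fun r hr => ⟨(h2 r hr).1.symm, (h2 r hr).2.symm⟩) hω₀⟩
        funext r
        simp only [f, (h2 r r.2).1, (h2 r r.2).2]
    have e2 : f ⁻¹' {f ω₀} ∩ {ω | θ ω = j ∧ ω ∈ S ∧ X (n+1) ω = x ∧ I (n+1) ω = c} =
        {ω | θ ω = j ∧ ∀ t ∈ Finset.Icc 1 (n+1),
          X t ω = (fun t => if t = n+1 then x else X t ω₀) t ∧
          I t ω = (fun t => if t = n+1 then c else I t ω₀) t} := by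
      have : f ⁻¹' {f ω₀} ∩ {ω | θ ω = j ∧ ω ∈ S ∧ X (n+1) ω = x ∧ I (n+1) ω = c} =
        (f ⁻¹' {f ω₀} ∩ {ω | θ ω = j ∧ ω ∈ S}) ∩ {ω | X (n+1) ω = x ∧ I (n+1) ω = c} := by
        ext ω
        simp only [Set.mem_inter_iff, Set.mem_setOf_eq]
        tauto
      rw [this, e1]
      ext ω
      simp only [Set.mem_inter_iff, Set.mem_setOf_eq, Finset.mem_Icc]
      constructor
      · rintro ⟨⟨h1, h2⟩, h3, h4⟩
        refine ⟨h1, fun t ht => ?_⟩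
        by_cases htn : t = n + 1
        · subst htn
          simp [h3, h4]
        · simp only [htn, if_false]
          exact h2 t ⟨ht.1, by omega⟩
      · rintro ⟨h1, h2⟩
        refine ⟨⟨h1, fun t ht => ?_⟩, ?_⟩
        · have := h2 t ⟨ht.1, by omega⟩
          simpa only [show t ≠ n + 1 by omega, if_false] using this
        · have := h2 (n+1) ⟨by omega, le_rfl⟩
          simpa using this
    rw [e1, e2]
    have j1 := hC.joint j hj (Finset.Icc 1 n) (fun t ht => (Finset.mem_Icc.1 ht).1)
      (fun t => X t ω₀) (fun t => I t ω₀) (fun t => hC.X_range t ω₀) (fun t => hC.I_range t ω₀)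
    have j2 := hC.joint j hj (Finset.Icc 1 (n+1)) (fun t ht => (Finset.mem_Icc.1 ht).1)
      (fun t => if t = n+1 then x else X t ω₀) (fun t => if t = n+1 then c else I t ω₀)
      (fun t => by
        by_cases h : t = n + 1
        · simpa [h] using hx
        · simpa [h] using hC.X_range t ω₀)
      (fun t => by
        by_cases h : t = n + 1
        · simpa [h] using hc
        · simpa [h] using hC.I_range t ω₀)
    simp only [Measure.real]
    rw [j1, j2, Finset.prod_Icc_succ_top (by omega)]
    have : ∏ k ∈ Finset.Icc 1 n, (signalProb a b j (if k = n+1 then x else X k ω₀) *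
        (if (if k = n+1 then c else I k ω₀) = 1 then p k else 1 - p k)) =
        ∏ k ∈ Finset.Icc 1 n, (signalProb a b j (X k ω₀) *
        (if I k ω₀ = 1 then p k else 1 - p k)) := by
      refine Finset.prod_congr rfl fun k hk => ?_
      have hk' : k ≠ n + 1 := by
        have := (Finset.mem_Icc.1 hk).2
        omega
      simp only [hk', if_false]
    rw [this]
    simp only [if_true]
    ring
  · have e1 : f ⁻¹' {v} ∩ {ω | θ ω = j ∧ ω ∈ S} = ∅ := by
      ext ω
      simp only [Set.mem_inter_iff, Set.mem_preimage, Set.mem_singleton_iff, Set.mem_setOf_eq,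
        Set.mem_empty_iff_false, iff_false]
      rintro ⟨h1, h2, h3⟩
      exact hv ⟨ω, h3, h1⟩
    have e2 : f ⁻¹' {v} ∩ {ω | θ ω = j ∧ ω ∈ S ∧ X (n+1) ω = x ∧ I (n+1) ω = c} = ∅ := by
      ext ω
      simp only [Set.mem_inter_iff, Set.mem_preimage, Set.mem_singleton_iff, Set.mem_setOf_eq,
        Set.mem_empty_iff_false, iff_false]
      rintro ⟨h1, h2, h3, _⟩
      exact hv ⟨ω, h3, h1⟩
    rw [e1, e2]
    simp

lemma mapEst_congr' (t : ℕ) (ω ω' : Ω) (h : ∀ s ∈ Finset.Icc 1 (t-1), Z s ω = Z s ω')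
    (hX : X t ω = X t ω') : mapEst μ θ X Z t ω = mapEst μ θ X Z t ω' := by
  have hD : ∀ i, Dlike μ θ X Z t i ω = Dlike μ θ X Z t i ω' := by
    intro i
    unfold Dlike
    congr 3
    ext ω''
    simp only [Set.mem_setOf_eq, hX]
    refine and_congr_right fun _ => and_congr_left fun _ => forall₂_congr fun s hs => ?_
    rw [h s hs]
  unfold mapEst
  rw [hD, hD, hX]

lemma Z_det (hC : IsCascade a b p μ θ X I Z) (n : ℕ) (ω ω' : Ω)
    (h : ∀ r ∈ Finset.Icc 1 n, X r ω = X r ω' ∧ I r ω = I r ω') :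
    ∀ s ∈ Finset.Icc 1 n, Z s ω = Z s ω' := by
  intro s
  induction s using Nat.strong_induction_on with
  | _ s ih =>
    intro hs
    have hs' := Finset.mem_Icc.1 hs
    rw [hC.dynamics s hs'.1, hC.dynamics s hs'.1, (h s hs).1, (h s hs).2,
      mapEst_congr' s ω ω' (fun r hr => ?_) (h s hs).1]
    have hr' := Finset.mem_Icc.1 hr
    exact ih r (by omega) (Finset.mem_Icc.2 ⟨hr'.1, by omega⟩)

lemma theta_half (hC : IsCascade a b p μ θ X I Z) (j : ℕ) (hj : j = 1 ∨ j = 2) :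
    (μ {ω | θ ω = j}).toReal = 1 / 2 := by
  have := hC.joint j hj ∅ (by simp) (fun _ => 1) (fun _ => 0) (by simp) (by simp)
  simpa using this

lemma X_marg (hC : IsCascade a b p μ θ X I Z) (j : ℕ) (hj : j = 1 ∨ j = 2) (n : ℕ)
    (S : Set Ω)
    (hS : ∀ ω ω', (∀ r ∈ Finset.Icc 1 n, X r ω = X r ω' ∧ I r ω = I r ω') → ω ∈ S → ω' ∈ S)
    (x : ℕ) (hx : x = 1 ∨ x = 2) :
    μ.real {ω | θ ω = j ∧ ω ∈ S ∧ X (n+1) ω = x}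
      = μ.real {ω | θ ω = j ∧ ω ∈ S} * signalProb a b j x := by
  have := hC.prob
  have hu : μ.real {ω | θ ω = j ∧ ω ∈ S ∧ X (n+1) ω = x} =
      μ.real {ω | θ ω = j ∧ ω ∈ S ∧ X (n+1) ω = x ∧ I (n+1) ω = 0} +
      μ.real {ω | θ ω = j ∧ ω ∈ S ∧ X (n+1) ω = x ∧ I (n+1) ω = 1} := by
    have hm : MeasurableSet {ω | I (n+1) ω = 0} := hC.I_meas (n+1) (measurableSet_singleton 0)
    rw [← measureReal_inter_add_diff hm]
    congr 2
    · ext ω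
      simp only [Set.mem_inter_iff, Set.mem_setOf_eq]
      tauto
    · ext ω
      simp only [Set.mem_diff, Set.mem_setOf_eq]
      have := hC.I_range (n+1) ω
      constructor
      · rintro ⟨⟨h1, h2, h3⟩, h4⟩
        exact ⟨h1, h2, h3, by omega⟩
      · rintro ⟨h1, h2, h3, h4⟩
        exact ⟨⟨h1, h2, h3⟩, by omega⟩
  rw [hu, indep_aux hC j hj n S hS x 0 hx (by simp), indep_aux hC j hj n S hS x 1 hx (by simp)]
  simp only [if_true, zero_ne_one, if_false]
  ring

lemma I_marg (ha : 0 < a) (hb : 0 < b)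
    (hC : IsCascade a b p μ θ X I Z) (j : ℕ) (hj : j = 1 ∨ j = 2) (n : ℕ)
    (S : Set Ω)
    (hS : ∀ ω ω', (∀ r ∈ Finset.Icc 1 n, X r ω = X r ω' ∧ I r ω = I r ω') → ω ∈ S → ω' ∈ S)
    (c : ℕ) (hc : c = 0 ∨ c = 1) :
    μ.real {ω | θ ω = j ∧ ω ∈ S ∧ I (n+1) ω = c}
      = μ.real {ω | θ ω = j ∧ ω ∈ S} * (if c = 1 then p (n+1) else 1 - p (n+1)) := by
  have := hC.prob
  have hu : μ.real {ω | θ ω = j ∧ ω ∈ S ∧ I (n+1) ω = c} =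
      μ.real {ω | θ ω = j ∧ ω ∈ S ∧ X (n+1) ω = 1 ∧ I (n+1) ω = c} +
      μ.real {ω | θ ω = j ∧ ω ∈ S ∧ X (n+1) ω = 2 ∧ I (n+1) ω = c} := by
    have hm : MeasurableSet {ω | X (n+1) ω = 1} := hC.X_meas (n+1) (measurableSet_singleton 1)
    rw [← measureReal_inter_add_diff hm]
    congr 2
    · ext ω
      simp only [Set.mem_inter_iff, Set.mem_setOf_eq]
      tauto
    · ext ω
      simp only [Set.mem_diff, Set.mem_setOf_eq]
      have := hC.X_range (n+1) ω
      constructor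
      · rintro ⟨⟨h1, h2, h3⟩, h4⟩
        exact ⟨h1, h2, by omega, h3⟩
      · rintro ⟨h1, h2, h3, h4⟩
        exact ⟨⟨h1, h2, h4⟩, by omega⟩
  rw [hu, indep_aux hC j hj n S hS 1 c (by simp) hc, indep_aux hC j hj n S hS 2 c (by simp) hc]
  have hs : signalProb a b j 1 + signalProb a b j 2 = 1 := by
    have : a + b ≠ 0 := by positivity
    rcases hj with rfl | rfl <;> simp [signalProb] <;> field_simp
    ring
  rw [← mul_add, ← add_mul, hs, one_mul]

/-- number of revealers up to time `n` -/
def numRev (I : ℕ → Ω → ℕ) (n : ℕ) (ω : Ω) : ℕ := ∑ i ∈ Finset.Icc 1 n, I i ω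

lemma numRev_tail (hb : 0 < b) (hab : b < a)
    (hC : IsCascade a b p μ θ X I Z) (n : ℕ) : ∀ k : ℕ,
    μ.real {ω | θ ω = 1 ∧ k ≤ numRev I n ω} ≤
      1 / 2 * ((a / b) ^ k)⁻¹ * ∏ i ∈ Finset.Icc 1 n, (1 + (a / b - 1) * p i) := by
  have := hC.prob
  have ha : 0 < a := hb.trans hab
  have hr : 1 < a / b := (one_lt_div hb).2 hab
  have hprod : ∀ n, 1 ≤ ∏ i ∈ Finset.Icc 1 n, (1 + (a / b - 1) * p i) := by
    intro n
    refine (Finset.prod_const_one (s := Finset.Icc 1 n) (M := ℝ)).symm.le.trans ?_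
    refine Finset.prod_le_prod (fun _ _ => zero_le_one) fun i hi => ?_
    have := (hC.p_mem i (Finset.mem_Icc.1 hi).1).1
    nlinarith
  have hhalf : μ.real {ω | θ ω = 1} = 1 / 2 := theta_half hC 1 (by simp)
  have hzero : ∀ n, μ.real {ω | θ ω = 1 ∧ 0 ≤ numRev I n ω} ≤
      1 / 2 * ((a / b) ^ 0)⁻¹ * ∏ i ∈ Finset.Icc 1 n, (1 + (a / b - 1) * p i) := by
    intro n
    simp only [zero_le, and_true, hhalf, pow_zero, inv_one, mul_one]
    linarith [hprod n]
  induction n with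
  | zero =>
    intro k
    cases k with
    | zero => exact hzero 0
    | succ k =>
      have : {ω | θ ω = 1 ∧ k + 1 ≤ numRev I 0 ω} = ∅ := by
        ext ω
        simp [numRev]
      rw [this]
      have := hprod 0
      simp only [measureReal_empty]
      positivity
  | succ n ih =>
    intro k
    cases k with
    | zero => exact hzero (n+1)
    | succ k =>
      have hdet : ∀ m ω ω', (∀ r ∈ Finset.Icc 1 n, X r ω = X r ω' ∧ I r ω = I r ω') →
          ω ∈ {ω | m ≤ numRev I n ω} → ω' ∈ {ω | m ≤ numRev I n ω} := by
        intro m ω ω' h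
        have : numRev I n ω = numRev I n ω' := Finset.sum_congr rfl fun r hr => (h r hr).2
        simp [this]
      have h0 := I_marg ha hb hC 1 (by simp) n _ (hdet (k+1)) 0 (by simp)
      have h1 := I_marg ha hb hC 1 (by simp) n _ (hdet k) 1 (by simp)
      simp only [Set.mem_setOf_eq, if_true, zero_ne_one, if_false] at h0 h1
      have hle : μ.real {ω | θ ω = 1 ∧ k + 1 ≤ numRev I (n+1) ω} ≤
          μ.real {ω | θ ω = 1 ∧ k + 1 ≤ numRev I n ω ∧ I (n+1) ω = 0} +
          μ.real {ω | θ ω = 1 ∧ k ≤ numRev I n ω ∧ I (n+1) ω = 1} := by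
        refine le_trans (measureReal_mono ?_) (measureReal_union_le _ _)
        rintro ω ⟨h1, h2⟩
        have hs : numRev I (n+1) ω = numRev I n ω + I (n+1) ω := by
          unfold numRev
          rw [Finset.sum_Icc_succ_top (by omega)]
        rw [hs] at h2
        rcases hC.I_range (n+1) ω with h | h
        · left
          exact ⟨h1, by omega, h⟩
        · right
          exact ⟨h1, by omega, h⟩
      rw [h0, h1] at hle
      refine hle.trans ?_
      have hp := hC.p_mem (n+1) (by omega)
      have i0 := mul_le_mul_of_nonneg_right (ih (k+1)) (sub_nonneg.2 hp.2)
      have i1 := mul_le_mul_of_nonneg_right (ih k) hp.1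
      refine (add_le_add i0 i1).trans (le_of_eq ?_)
      rw [Finset.prod_Icc_succ_top (by omega)]
      have hr0 : a / b ≠ 0 := by positivity
      generalize a / b = r at *
      rw [pow_succ, mul_inv]
      have : (r ^ k)⁻¹ = (r ^ k)⁻¹ * r⁻¹ * r := by field_simp
      rw [this]
      field_simp
      ring

lemma step_ratio (hb : 0 < b) (hab : b < a) (hC : IsCascade a b p μ θ X I Z)
    (hpos : ∀ t, 1 ≤ t → 0 < p t) (n : ℕ) (ω : Ω) (hR : a / b < LR μ θ Z n ω) :
    ((a / b) ^ (I (n+1) ω))⁻¹ ≤ LR μ θ Z (n+1) ω / LR μ θ Z n ω := by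
  have := hC.prob
  have ha : 0 < a := hb.trans hab
  have hr : 1 < a / b := (one_lt_div hb).2 hab
  set H : Set Ω := {ω' | ∀ s ∈ Finset.Icc 1 n, Z s ω' = Z s ω} with hH
  have hdet : ∀ ω₁ ω₂, (∀ r ∈ Finset.Icc 1 n, X r ω₁ = X r ω₂ ∧ I r ω₁ = I r ω₂) →
      ω₁ ∈ H → ω₂ ∈ H := by
    intro ω₁ ω₂ h h1 s hs
    rw [← Z_det hC n ω₁ ω₂ h s hs]
    exact h1 s hs
  set A : ℕ → ℝ := fun j => μ.real {ω' | θ ω' = j ∧ ω' ∈ H} with hA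
  have hL : ∀ j, j = 1 ∨ j = 2 → Llike μ θ Z n j ω = 2 * A j := by
    intro j hj
    unfold Llike
    rw [theta_half hC j hj]
    simp only [hA, hH, Measure.real, Set.mem_setOf_eq]
    ring
  have hLR : LR μ θ Z n ω = A 1 / A 2 := by
    unfold LR
    rw [hL 1 (by simp), hL 2 (by simp)]
    exact mul_div_mul_left _ _ two_ne_zero
  have hA0 : ∀ j, 0 ≤ A j := fun j => measureReal_nonneg
  rw [hLR] at hR
  have hA2 : 0 < A 2 := by
    rcases (hA0 2).lt_or_eq with h | h
    · exact h
    · rw [← h, div_zero] at hR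
      linarith
  have hA12 : a * A 2 < b * A 1 := by
    rw [div_lt_div_iff₀ hb hA2] at hR
    linarith
  have hA1 : 0 < A 1 := by
    by_contra h
    nlinarith [mul_pos ha hA2]
  -- the Bayesian choice is 1 on H
  have hmap : ∀ ω' ∈ H, mapEst μ θ X Z (n+1) ω' = 1 := by
    intro ω' hω'
    have hD : ∀ j, j = 1 ∨ j = 2 →
        Dlike μ θ X Z (n+1) j ω' = 2 * (A j * signalProb a b j (X (n+1) ω')) := by
      intro j hj
      unfold Dlike
      rw [theta_half hC j hj]
      have hset : {ω'' | θ ω'' = j ∧ (∀ s ∈ Finset.Icc 1 (n + 1 - 1), Z s ω'' = Z s ω') ∧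
          X (n+1) ω'' = X (n+1) ω'} =
          {ω'' | θ ω'' = j ∧ ω'' ∈ H ∧ X (n+1) ω'' = X (n+1) ω'} := by
        ext ω''
        simp only [Set.mem_setOf_eq, hH, Nat.add_sub_cancel]
        refine and_congr_right fun _ => and_congr_left fun _ => forall₂_congr fun s hs => ?_
        rw [hω' s hs]
      have hx := X_marg hC j hj n H hdet (X (n+1) ω') (hC.X_range _ _)
      rw [hset]
      simp only [Measure.real] at hx
      rw [hx]
      simp only [hA, Measure.real]
      ring
    unfold mapEst
    rw [hD 1 (by simp), hD 2 (by simp), if_pos]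
    have hab' : 0 < a + b := by positivity
    rcases hC.X_range (n+1) ω' with h | h <;> rw [h] <;> simp only [signalProb] <;> norm_num
    · rw [mul_div_assoc', mul_div_assoc']
      refine div_lt_div_of_pos_right ?_ hab'
      nlinarith
    · rw [mul_div_assoc', mul_div_assoc']
      refine div_lt_div_of_pos_right ?_ hab'
      nlinarith
  have hZ : ∀ ω' ∈ H, Z (n+1) ω' = if I (n+1) ω' = 1 then X (n+1) ω' else 1 := by
    intro ω' hω'
    rw [hC.dynamics (n+1) (by omega), hmap ω' hω']
  have hL' : ∀ j, j = 1 ∨ j = 2 → Llike μ θ Z (n+1) j ω =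
      2 * μ.real {ω' | θ ω' = j ∧ ω' ∈ H ∧ Z (n+1) ω' = Z (n+1) ω} := by
    intro j hj
    unfold Llike
    rw [theta_half hC j hj]
    have hset : {ω' | θ ω' = j ∧ ∀ s ∈ Finset.Icc 1 (n+1), Z s ω' = Z s ω} =
        {ω' | θ ω' = j ∧ ω' ∈ H ∧ Z (n+1) ω' = Z (n+1) ω} := by
      ext ω'
      simp only [Set.mem_setOf_eq, hH]
      refine and_congr_right fun _ => ?_
      constructor
      · intro h
        refine ⟨fun s hs => h s ?_, h _ (by simp)⟩
        have := Finset.mem_Icc.1 hs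
        exact Finset.mem_Icc.2 ⟨this.1, by omega⟩
      · rintro ⟨h1, h2⟩ s hs
        have hs' := Finset.mem_Icc.1 hs
        by_cases hsn : s = n + 1
        · rw [hsn, h2]
        · exact h1 s (Finset.mem_Icc.2 ⟨hs'.1, by omega⟩)
    rw [hset]
    simp only [Measure.real]
    ring
  have hm2 : ∀ j, j = 1 ∨ j = 2 → μ.real {ω' | θ ω' = j ∧ ω' ∈ H ∧ Z (n+1) ω' = 2} =
      A j * (signalProb a b j 2 * p (n+1)) := by
    intro j hj
    have h := indep_aux hC j hj n H hdet 2 1 (by simp) (by simp)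
    simp only [if_true] at h
    rw [hA, ← h]
    congr 1
    ext ω'
    simp only [Set.mem_setOf_eq]
    refine and_congr_right fun _ => and_congr_right fun hω' => ?_
    rw [hZ ω' hω']
    by_cases hI : I (n+1) ω' = 1 <;> simp [hI]
  have hm1 : ∀ j, j = 1 ∨ j = 2 → μ.real {ω' | θ ω' = j ∧ ω' ∈ H ∧ Z (n+1) ω' = 1} =
      A j * (1 - signalProb a b j 2 * p (n+1)) := by
    intro j hj
    have hm : MeasurableSet {ω | Z (n+1) ω = 2} := hC.Z_meas (n+1) (measurableSet_singleton 2)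
    have hs := measureReal_inter_add_diff (μ := μ) (s := {ω' | θ ω' = j ∧ ω' ∈ H}) hm
    have e1 : {ω' | θ ω' = j ∧ ω' ∈ H} ∩ {ω | Z (n+1) ω = 2} =
        {ω' | θ ω' = j ∧ ω' ∈ H ∧ Z (n+1) ω' = 2} := by
      ext ω'
      simp only [Set.mem_inter_iff, Set.mem_setOf_eq]
      tauto
    have e2 : {ω' | θ ω' = j ∧ ω' ∈ H} \ {ω | Z (n+1) ω = 2} =
        {ω' | θ ω' = j ∧ ω' ∈ H ∧ Z (n+1) ω' = 1} := by
      ext ω'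
      simp only [Set.mem_diff, Set.mem_setOf_eq, and_assoc]
      refine and_congr_right fun _ => and_congr_right fun hω' => ?_
      have h1 := hZ ω' hω'
      have h2 := hC.X_range (n+1) ω'
      split_ifs at h1 <;> omega
    rw [e1, e2, hm2 j hj] at hs
    simp only [hA] at hs ⊢
    linarith
  have hωH : ω ∈ H := fun s _ => rfl
  have hp1 := hpos (n+1) (by omega)
  have hp2 := (hC.p_mem (n+1) (by omega)).2
  have hab' : 0 < a + b := by positivity
  have key1 : Z (n+1) ω = 1 → 1 ≤ LR μ θ Z (n+1) ω / LR μ θ Z n ω := by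
    intro hz
    have s1 : signalProb a b 1 2 = b / (a + b) := by simp [signalProb]
    have s2 : signalProb a b 2 2 = a / (a + b) := by simp [signalProb]
    rw [hLR]
    unfold LR
    rw [hL' 1 (by simp), hL' 2 (by simp), hz, hm1 1 (by simp), hm1 2 (by simp), s1, s2]
    have q2 : a / (a + b) * p (n+1) < 1 := by
      have : a / (a + b) < 1 := (div_lt_one hab').2 (by linarith)
      nlinarith
    have q12 : b / (a + b) * p (n+1) ≤ a / (a + b) * p (n+1) := by gcongr
    have hpos2 : 0 < 1 - a / (a + b) * p (n+1) := by linarith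
    have : 2 * (A 1 * (1 - b / (a + b) * p (n+1))) / (2 * (A 2 * (1 - a / (a + b) * p (n+1))))
        / (A 1 / A 2) = (1 - b / (a + b) * p (n+1)) / (1 - a / (a + b) * p (n+1)) := by
      generalize 1 - a / (a + b) * p (n+1) = u at *
      generalize 1 - b / (a + b) * p (n+1) = v at *
      field_simp
    rw [this, one_le_div hpos2]
    linarith
  have key2 : Z (n+1) ω = 2 → (a / b)⁻¹ ≤ LR μ θ Z (n+1) ω / LR μ θ Z n ω := by
    intro hz
    have s1 : signalProb a b 1 2 = b / (a + b) := by simp [signalProb]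
    have s2 : signalProb a b 2 2 = a / (a + b) := by simp [signalProb]
    rw [hLR]
    unfold LR
    rw [hL' 1 (by simp), hL' 2 (by simp), hz, hm2 1 (by simp), hm2 2 (by simp), s1, s2]
    apply le_of_eq
    field_simp
  rcases hC.I_range (n+1) ω with hI | hI
  · rw [hI]
    simp only [pow_zero, inv_one]
    apply key1
    rw [hZ ω hωH, hI]
    simp
  · rw [hI, pow_one]
    rcases hC.X_range (n+1) ω with hx | hx
    · refine le_trans (inv_le_one_of_one_le₀ hr.le) (key1 ?_)
      rw [hZ ω hωH, hI, hx]
      simp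
    · apply key2
      rw [hZ ω hωH, hI, hx]
      simp

lemma Rone_lower (hb : 0 < b) (hab : b < a) (hC : IsCascade a b p μ θ X I Z)
    (hpos : ∀ t, 1 ≤ t → 0 < p t) (t : ℕ) (ω : Ω) :
    ((a / b) ^ (numRev I t ω))⁻¹ ≤ Rone a b μ θ Z t ω := by
  have hr : 1 < a / b := (one_lt_div hb).2 hab
  unfold Rone numRev
  rw [Finset.prod_filter, ← Finset.prod_pow_eq_pow_sum, ← Finset.prod_inv_distrib]
  refine Finset.prod_le_prod (fun i _ => by positivity) fun i hi => ?_
  obtain ⟨n, rfl⟩ : ∃ n, i = n + 1 := ⟨i - 1, by have := (Finset.mem_Icc.1 hi).1; omega⟩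
  split_ifs with h
  · exact step_ratio hb hab hC hpos n ω h
  · exact inv_le_one_of_one_le₀ (one_le_pow₀ hr.le)

lemma kappaStar_ne_zero (hb : 0 < b) (hab : b < a) : kappaStar a b ≠ 0 := by
  have hr : 1 < a / b := (one_lt_div hb).2 hab
  unfold kappaStar
  generalize a / b = r at *
  have hl : 0 < Real.log r := Real.log_pos hr
  have hl2 : Real.log r < r - 1 := Real.log_lt_sub_one_of_pos (by linarith) hr.ne'
  have hy : 1 < (r - 1) / Real.log r := (one_lt_div hl).2 hl2
  generalize (r - 1) / Real.log r = y at *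
  have h := Real.log_lt_sub_one_of_pos (x := y⁻¹) (by positivity) (inv_lt_one_of_one_lt₀ hy).ne
  rw [Real.log_inv] at h
  have : 0 < 1 + y * (Real.log y - 1) := by
    have h2 := mul_lt_mul_of_pos_left h (show 0 < y by linarith)
    have : y * (y⁻¹ - 1) = 1 - y := by field_simp
    linarith
  positivity

end helpers

/-- With `p_t = min((1+ε)·((a+b)/b)·κ*(a,b)/t, 1)`, there is a constant
`C₁ < ∞` (depending on `a`, `b`, `ε`) such that for all sufficiently large `t`,
`P_1(R_t^{(1)} ≤ t^{−C₁}) ≤ t^{−2}`. -/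
theorem Rone_not_too_small (a b : ℝ) (hb : 0 < b) (hab : b < a)
    (ε : ℝ) (hε : 0 < ε) (p : ℕ → ℝ)
    (hp : ∀ t : ℕ, 1 ≤ t →
      p t = min ((1 + ε) * ((a + b) / b) * kappaStar a b / t) 1)
    {Ω : Type*} [MeasurableSpace Ω] (μ : Measure Ω) (θ : Ω → ℕ)
    (X I Z : ℕ → Ω → ℕ) (hC : IsCascade a b p μ θ X I Z) :
    ∃ C₁ : ℝ, ∃ N : ℕ, ∀ t : ℕ, N ≤ t →
      (μ[|{ω | θ ω = 1}]
          {ω | Rone a b μ θ Z t ω ≤ (t : ℝ) ^ (-C₁)}).toReal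
        ≤ (t : ℝ) ^ (-2 : ℝ) := by
  have := hC.prob
  have ha : 0 < a := hb.trans hab
  have hr : 1 < a / b := (one_lt_div hb).2 hab
  set c : ℝ := (1 + ε) * ((a + b) / b) * kappaStar a b with hc
  have hc0 : 0 < c := by
    have h1 : c ≠ 0 := by
      rw [hc]
      have := kappaStar_ne_zero hb hab
      have h2 : (1 + ε) * ((a + b) / b) ≠ 0 := by positivity
      exact mul_ne_zero h2 this
    have h2 := (hC.p_mem 1 le_rfl).1
    rw [hp 1 le_rfl] at h2
    have h3 := h2.trans (min_le_left _ _)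
    simp only [Nat.cast_one, div_one] at h3
    exact lt_of_le_of_ne h3 h1.symm
  have hpos : ∀ t, 1 ≤ t → 0 < p t := by
    intro t ht
    rw [hp t ht]
    have : (0 : ℝ) < t := by exact_mod_cast ht
    exact lt_min (by positivity) one_pos
  set d : ℝ := (a / b - 1) * c with hd
  have hd0 : 0 < d := mul_pos (by linarith) hc0
  refine ⟨d + 3, max 2 ⌈Real.exp d⌉₊, fun t ht => ?_⟩
  have ht2 : 2 ≤ t := le_trans (le_max_left _ _) ht
  have hte : Real.exp d ≤ t := (Nat.le_ceil _).trans (by exact_mod_cast (le_max_right _ _).trans ht)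
  have ht0 : (0 : ℝ) < t := by positivity
  -- bound on the product
  have hprod : ∏ i ∈ Finset.Icc 1 t, (1 + (a / b - 1) * p i) ≤ (t : ℝ) ^ (d + 1) := by
    have h1 : ∏ i ∈ Finset.Icc 1 t, (1 + (a / b - 1) * p i) ≤
        ∏ i ∈ Finset.Icc 1 t, Real.exp (d * (i : ℝ)⁻¹) := by
      refine Finset.prod_le_prod (fun i hi => ?_) fun i hi => ?_
      · have := hpos i (Finset.mem_Icc.1 hi).1
        nlinarith
      · have hi1 := (Finset.mem_Icc.1 hi).1
        have h2 : p i ≤ c / i := by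
          rw [hp i hi1]
          exact min_le_left _ _
        have h3 := mul_le_mul_of_nonneg_left h2 (show 0 ≤ a / b - 1 by linarith)
        have h4 := Real.add_one_le_exp (d * (i : ℝ)⁻¹)
        have h5 : (a / b - 1) * (c / i) = d * (i : ℝ)⁻¹ := by
          rw [hd]
          ring
        linarith
    refine h1.trans ?_
    rw [← Real.exp_sum, ← Finset.mul_sum]
    have h2 := harmonic_le_one_add_log t
    rw [harmonic_eq_sum_Icc] at h2
    push_cast at h2
    have h3 := mul_le_mul_of_nonneg_left h2 hd0.le
    have h4 : d ≤ Real.log t := by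
      rw [Real.le_log_iff_exp_le ht0]
      exact hte
    rw [Real.rpow_def_of_pos ht0]
    refine Real.exp_le_exp.2 ?_
    nlinarith
  have hex : ∃ k : ℕ, (t : ℝ) ^ (d + 3) ≤ (a / b) ^ k :=
    (pow_unbounded_of_one_lt _ hr).imp fun _ h => h.le
  classical
  set k := Nat.find hex with hk
  have hkspec : (t : ℝ) ^ (d + 3) ≤ (a / b) ^ k := Nat.find_spec hex
  have hsub : {ω | θ ω = 1} ∩ {ω | Rone a b μ θ Z t ω ≤ (t : ℝ) ^ (-(d + 3))} ⊆
      {ω | θ ω = 1 ∧ k ≤ numRev I t ω} := by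
    rintro ω ⟨h1, h2⟩
    refine ⟨h1, Nat.find_min' hex ?_⟩
    have h3 := (Rone_lower hb hab hC hpos t ω).trans h2
    rw [Real.rpow_neg ht0.le] at h3
    exact (inv_le_inv₀ (by positivity) (by positivity)).1 h3
  have hm : MeasurableSet {ω | θ ω = 1} := hC.theta_meas (measurableSet_singleton 1)
  have hhalf := theta_half hC 1 (by simp)
  rw [cond_apply hm, ENNReal.toReal_mul, ENNReal.toReal_inv, hhalf]
  have h1 : (μ ({ω | θ ω = 1} ∩ {ω | Rone a b μ θ Z t ω ≤ (t : ℝ) ^ (-(d + 3))})).toReal ≤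
      1 / 2 * ((a / b) ^ k)⁻¹ * ∏ i ∈ Finset.Icc 1 t, (1 + (a / b - 1) * p i) :=
    (measureReal_mono hsub).trans (numRev_tail hb hab hC t k)
  have h2 : ((a / b) ^ k)⁻¹ * ∏ i ∈ Finset.Icc 1 t, (1 + (a / b - 1) * p i) ≤
      ((t : ℝ) ^ (d + 3))⁻¹ * (t : ℝ) ^ (d + 1) := by
    refine mul_le_mul ?_ hprod ?_ (by positivity)
    · exact inv_anti₀ (by positivity) hkspec
    · refine Finset.prod_nonneg fun i hi => ?_
      have := hpos i (Finset.mem_Icc.1 hi).1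
      nlinarith
  have h3 : ((t : ℝ) ^ (d + 3))⁻¹ * (t : ℝ) ^ (d + 1) = (t : ℝ) ^ (-2 : ℝ) := by
    rw [← Real.rpow_neg ht0.le, ← Real.rpow_add ht0]
    congr 1
    ring
  rw [h3] at h2
  norm_num at h1 h2 ⊢
  linarith
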